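/- For β ∈ ℝ set τU_β := ⊕_{k∈ℤ} τ^k ⊗ (V_{β+k} ∩ M) ⊆ τM, and let q : τM → ℂ[z,z⁻¹] ⊗_ℂ H be the surjection q(τ^k ⊗ m) := z^k ⊗ [m], whose kernel is (τ−z)·τM. Then for every α ∈ ℝ: (a) (τ−z)·τM ∩ τU_α = (τ−z)·τU_α; (b) q(τU_α) = ⊕_{k∈ℤ} z^k ⊗ F^irr_{α+k} H. Consequently τU_α/(τ−z)·τU_α is isomorphic to the Rees module ⊕_{k∈ℤ} z^k ⊗ F^irr_{α+k} H ⊆ ℂ[z,z⁻¹] ⊗_ℂ H of the irregular Hodge filtration. (Grading property and formula (eq:gradingpoint) in the proof of Proposition 2.4.2 of 'Irregular Hodge theory': M is graded well-rescalable and the rescaled V-filtration computes the irregular Hodge filtration.) -/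

import Mathlib

noncomputable section

open Submodule Set

variable {N : Type*} [AddCommGroup N] [Module ℂ N]

/-- `M` is (the image of) a finite free `ℂ[z]`-module of rank `r` inside
`N = ℂ[z,z⁻¹] ⊗_{ℂ[z]} M`, where multiplication by `z` is the automorphism `z` of `N`.
This is encoded by `z`-stability of `M` together with the existence of an `r`-element
family `b` of elements of `M` such that `(z^k (b i))` for `k ∈ ℤ` is a `ℂ`-basis of `N`
and `(z^k (b i))` for `k ∈ ℕ` is a `ℂ`-basis of `M`. -/
def IsFreeLattice (z : N ≃ₗ[ℂ] N) (M : Submodule ℂ N) (r : ℕ) : Prop :=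
  (∀ x ∈ M, z x ∈ M) ∧
  ∃ b : Fin r → N,
    LinearIndependent ℂ (fun p : Fin r × ℤ => (z ^ p.2) (b p.1)) ∧
    Submodule.span ℂ (Set.range fun p : Fin r × ℤ => (z ^ p.2) (b p.1)) = ⊤ ∧
    Submodule.span ℂ (Set.range fun p : Fin r × ℕ => (z ^ (p.2 : ℤ)) (b p.1)) = M

/-- A V-lattice filtration on `N` (with jumps in `A + ℤ`, `A ⊆ [0,1)` finite):
(i) increasing; (ii) `z · V_β = V_{β+1}`; (iii) each `V_β` is stable under `z⁻¹` and
finitely generated over `ℂ[z⁻¹]`; (iv) the `ℂ[z,z⁻¹]`-span of each `V_β` is `N`;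
(v) `V_β = V_γ` if `(β,γ] ∩ (A + ℤ) = ∅`. -/
structure IsVLattice (z : N ≃ₗ[ℂ] N) (V : ℝ → Submodule ℂ N) (A : Finset ℝ) : Prop where
  mono : Monotone V
  map_z : ∀ β : ℝ, (V β).map z.toLinearMap = V (β + 1)
  zinv_stable : ∀ β : ℝ, ∀ x ∈ V β, z.symm x ∈ V β
  fg_zinv : ∀ β : ℝ, ∃ S : Finset N, (S : Set N) ⊆ (V β : Set N) ∧
    V β = Submodule.span ℂ {x : N | ∃ k : ℕ, ∃ s ∈ S, x = (z.symm ^ k) s}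
  span_laurent : ∀ β : ℝ, Submodule.span ℂ {x : N | ∃ k : ℤ, ∃ v ∈ V β, x = (z ^ k) v} = ⊤
  jumpsIn : ∀ a ∈ A, (0 : ℝ) ≤ a ∧ a < 1
  jumps : ∀ β γ : ℝ, β ≤ γ →
    (∀ a ∈ A, ∀ k : ℤ, ¬ (β < a + k ∧ a + k ≤ γ)) → V β = V γ

/-- `V_{<β} := ⋃_{γ < β} V_γ`. -/
def Vlt (V : ℝ → Submodule ℂ N) (β : ℝ) : Submodule ℂ N := ⨆ γ ∈ Set.Iio β, V γ

/-- The Harder–Narasimhan filtration of `N`: `F^HN_β(N)` is the `ℂ[z,z⁻¹]`-span of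
`V_β ∩ M`. -/
def FHN (z : N ≃ₗ[ℂ] N) (V : ℝ → Submodule ℂ N) (M : Submodule ℂ N) (β : ℝ) :
    Submodule ℂ N :=
  Submodule.span ℂ {x : N | ∃ k : ℤ, ∃ v ∈ V β ⊓ M, x = (z ^ k) v}


/-- The submodule of `ℤ →₀ P` of elements with `k`-th component in `W k`; this is the
internal direct sum `⊕_{k∈ℤ} τ^k ⊗ W k` inside `τP = ℂ[τ,τ⁻¹] ⊗_ℂ P = ℤ →₀ P`. -/
def finsuppPi {P : Type*} [AddCommGroup P] [Module ℂ P] (W : ℤ → Submodule ℂ P) :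
    Submodule ℂ (ℤ →₀ P) where
  carrier := {f | ∀ k : ℤ, f k ∈ W k}
  add_mem' := by
    intro f g hf hg k
    rw [Finsupp.add_apply]; exact add_mem (hf k) (hg k)
  zero_mem' := by intro k; rw [Finsupp.zero_apply]; exact zero_mem _
  smul_mem' := by
    intro c f hf k
    rw [Finsupp.smul_apply]; exact Submodule.smul_mem _ c (hf k)

/-- The action of `τ` on the rescaled module `τN = ℤ →₀ N` (shift of indices). -/
def Tsh (P : Type*) [AddCommGroup P] [Module ℂ P] : (ℤ →₀ P) ≃ₗ[ℂ] (ℤ →₀ P) :=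
  Finsupp.domLCongr (Equiv.addRight (1 : ℤ))

/-- The action of `z` on the rescaled module: `z·(τ^k ⊗ m) = τ^{k+1} ⊗ (z·m)`. -/
def Zop (z : N ≃ₗ[ℂ] N) : (ℤ →₀ N) →ₗ[ℂ] (ℤ →₀ N) :=
  (Tsh N).toLinearMap ∘ₗ Finsupp.mapRange.linearMap z.toLinearMap

/-- The action of `τ·ð_τ` (`ð_τ = z∂_τ`) on the rescaled module:
`Θ(τ^k ⊗ m) = τ^{k+1} ⊗ (z·∇(m) + k·z·m)`. -/
def Theta (z : N ≃ₗ[ℂ] N) (nab : N →ₗ[ℂ] N) : (ℤ →₀ N) →ₗ[ℂ] (ℤ →₀ N) :=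
  Finsupp.lsum ℂ fun k : ℤ =>
    (Finsupp.lsingle (k + 1)) ∘ₗ (z.toLinearMap ∘ₗ nab + (k : ℂ) • z.toLinearMap)

/-- `τU_β := ⊕_{k∈ℤ} τ^k ⊗ (V_{β+k} ∩ M) ⊆ τM`. -/
def tauU (V : ℝ → Submodule ℂ N) (M : Submodule ℂ N) (β : ℝ) : Submodule ℂ (ℤ →₀ N) :=
  finsuppPi fun k : ℤ => V (β + k) ⊓ M

/-- `(z−1)·M`. -/
def Kz (z : N ≃ₗ[ℂ] N) (M : Submodule ℂ N) : Submodule ℂ N :=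
  M.map (z.toLinearMap - LinearMap.id)

/-- `q : τM → ℂ[z,z⁻¹] ⊗_ℂ H`, `τ^k ⊗ m ↦ z^k ⊗ [m]`, where `H = M/(z−1)M` embeds in
`N/(z−1)M` and `ℂ[z,z⁻¹] ⊗ (N/(z−1)M)` is modelled as `ℤ →₀ (N/(z−1)M)`. -/
def qmap (z : N ≃ₗ[ℂ] N) (M : Submodule ℂ N) :
    (ℤ →₀ N) →ₗ[ℂ] (ℤ →₀ (N ⧸ Kz z M)) :=
  Finsupp.mapRange.linearMap (Kz z M).mkQ

/-- The irregular Hodge filtration `F^irr_β H`: the image of `V_β ∩ M` in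
`H = M/(z−1)M ⊆ N/(z−1)M`. -/
def Firr (z : N ≃ₗ[ℂ] N) (V : ℝ → Submodule ℂ N) (M : Submodule ℂ N) (β : ℝ) :
    Submodule ℂ (N ⧸ Kz z M) :=
  (V β ⊓ M).map (Kz z M).mkQ

namespace IsVLattice

variable {z : N ≃ₗ[ℂ] N} {V : ℝ → Submodule ℂ N} {A : Finset ℝ}

theorem z_mem_iff (hV : IsVLattice z V A) {β : ℝ} {x : N} : z x ∈ V (β + 1) ↔ x ∈ V β := by
  rw [← hV.map_z β]
  constructor
  · rintro ⟨y, hy, hyx⟩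
    exact z.injective hyx ▸ hy
  · exact fun hx => ⟨x, hx, rfl⟩

theorem zpow_mem (hV : IsVLattice z V A) {β : ℝ} {x : N} (hx : x ∈ V β) (k : ℤ) :
    (z ^ k) x ∈ V (β + k) := by
  induction k using Int.induction_on with
  | zero => simpa using hx
  | succ n ih =>
    have h := hV.z_mem_iff.2 ih
    rw [add_comm (n : ℤ) 1, zpow_add, zpow_one, LinearEquiv.mul_apply]
    convert h using 2
    push_cast
    ring
  | pred n ih =>
    apply hV.z_mem_iff.1
    have h : z ((z ^ (-(n : ℤ) - 1)) x) = (z ^ (-(n : ℤ))) x := by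
      rw [← LinearEquiv.mul_apply, ← zpow_one_add]
      congr 2
      ring
    rw [h]
    convert ih using 2
    push_cast
    ring

/-- The filtration is exhaustive. -/
theorem exists_mem (hV : IsVLattice z V A) (x : N) : ∃ γ : ℝ, x ∈ V γ := by
  have hx : x ∈ Submodule.span ℂ {x : N | ∃ k : ℤ, ∃ v ∈ V 0, x = (z ^ k) v} := by
    rw [hV.span_laurent 0]
    trivial
  induction hx using Submodule.span_induction with
  | mem x hx =>
    obtain ⟨k, v, hv, rfl⟩ := hx
    exact ⟨_, hV.zpow_mem hv k⟩
  | zero => exact ⟨0, zero_mem _⟩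
  | add x y _ _ hx hy =>
    obtain ⟨γ, hγ⟩ := hx
    obtain ⟨δ, hδ⟩ := hy
    exact ⟨max γ δ, add_mem (hV.mono (le_max_left _ _) hγ) (hV.mono (le_max_right _ _) hδ)⟩
  | smul c x _ hx =>
    obtain ⟨γ, hγ⟩ := hx
    exact ⟨γ, Submodule.smul_mem _ c hγ⟩

/-- Multiplication by `1 - z` is strict with respect to the filtration, with a shift by one. -/
theorem sub_z_mem_iff (hV : IsVLattice z V A) {β : ℝ} {x : N} :
    x - z x ∈ V (β + 1) ↔ x ∈ V β := by
  refine ⟨fun h => ?_, fun h => sub_mem (hV.mono (by linarith) h) (hV.z_mem_iff.2 h)⟩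
  obtain ⟨γ, hγ⟩ := hV.exists_mem x
  have key : ∀ n : ℕ, x ∈ V (max (γ - n) β) := by
    intro n
    induction n with
    | zero => exact hV.mono (by simp) hγ
    | succ n ih =>
      rw [← hV.z_mem_iff]
      have hz : z x = x - (x - z x) := by abel
      rw [hz]
      refine sub_mem (hV.mono (max_le ?_ ?_) ih) (hV.mono ?_ h)
      · push_cast
        linarith [le_max_left (γ - (n + 1)) β]
      · linarith [le_max_right (γ - ((n + 1 : ℕ) : ℝ)) β]
      · linarith [le_max_right (γ - ((n + 1 : ℕ) : ℝ)) β]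
  obtain ⟨n, hn⟩ := exists_nat_ge (γ - β)
  exact hV.mono (max_le (by linarith) le_rfl) (key n)

end IsVLattice

open Classical in
theorem map_mapRange_finsuppPi {P Q : Type*} [AddCommGroup P] [Module ℂ P] [AddCommGroup Q]
    [Module ℂ Q] (φ : P →ₗ[ℂ] Q) (W : ℤ → Submodule ℂ P) :
    (finsuppPi W).map (Finsupp.mapRange.linearMap φ) = finsuppPi fun k => (W k).map φ := by
  ext g
  constructor
  · rintro ⟨f, hf, rfl⟩ k
    exact ⟨f k, hf k, by simp⟩
  · intro hg
    choose m hmW hm using hg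
    refine ⟨Finsupp.onFinset g.support (fun k => if g k = 0 then 0 else m k) ?_, ?_, ?_⟩
    · intro k hk
      simp_all
    · intro k
      simp only [Finsupp.onFinset_apply]
      split_ifs
      · exact zero_mem _
      · exact hmW k
    · ext k
      by_cases h : g k = 0 <;> simp [h, hm]

theorem Tsh_sub_Zop_apply (z : N ≃ₗ[ℂ] N) (f : ℤ →₀ N) (k : ℤ) :
    ((Tsh N).toLinearMap - Zop z) f (k + 1) = f k - z (f k) := by
  simp [Tsh, Zop, Finsupp.domLCongr_apply, Finsupp.equivMapDomain_apply]

/-- Grading property and formula (eq:gradingpoint) in the proof of Proposition 2.4.2: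
for every `α ∈ ℝ`,
(a) `(τ−z)·τM ∩ τU_α = (τ−z)·τU_α`;
(b) `q(τU_α) = ⊕_{k∈ℤ} z^k ⊗ F^irr_{α+k} H`, the Rees module of the irregular Hodge
filtration. -/
theorem statement17 (z : N ≃ₗ[ℂ] N) (M : Submodule ℂ N) (r : ℕ)
    (V : ℝ → Submodule ℂ N) (A : Finset ℝ)
    (hM : IsFreeLattice z M r) (hV : IsVLattice z V A) :
    ∀ α : ℝ,
      -- (a)
      (Submodule.map ((Tsh N).toLinearMap - Zop z) (finsuppPi fun _ : ℤ => M) ⊓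
          tauU V M α =
        Submodule.map ((Tsh N).toLinearMap - Zop z) (tauU V M α)) ∧
      -- (b)
      Submodule.map (qmap z M) (tauU V M α) =
        finsuppPi (fun k : ℤ => Firr z V M (α + k)) := by
  intro α
  refine ⟨?_, map_mapRange_finsuppPi _ _⟩
  have shift (k : ℤ) : α + ((k + 1 : ℤ) : ℝ) = α + k + 1 := by
    push_cast
    ring
  ext g
  constructor
  · rintro ⟨⟨f, hf, rfl⟩, hg⟩
    refine ⟨f, fun k => ⟨?_, hf k⟩, rfl⟩
    have h := (hg (k + 1)).1
    rw [Tsh_sub_Zop_apply, shift] at h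
    exact hV.sub_z_mem_iff.1 h
  · rintro ⟨f, hf, rfl⟩
    refine ⟨⟨f, fun k => (hf k).2, rfl⟩, fun k => ?_⟩
    obtain ⟨j, rfl⟩ : ∃ j, k = j + 1 := ⟨k - 1, by ring⟩
    rw [Tsh_sub_Zop_apply]
    beta_reduce
    rw [shift]
    exact ⟨hV.sub_z_mem_iff.2 (hf j).1, sub_mem (hf j).2 (hM.1 _ (hf j).2)⟩
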